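/- Fix a real number p ≥ 2 and an integer n ≥ 1, and let φ_n be as defined in the context. Then (φ_n'(r))² ≤ 4p·φ_n''(r)·φ_n(r) for every r ∈ ℝ. -/

import Mathlib

/-- The truncated power function `φ_n`: `φ_n(r) = |r|^p` for `|r| < n`, and the second-order
Taylor extension `n^{p-2} (p(p-1)/2)(|r|-n)² + p n^{p-1}(|r|-n) + n^p` for `|r| ≥ n`. -/
noncomputable def phi (p : ℝ) (n : ℕ) (r : ℝ) : ℝ :=
  if |r| < n then |r| ^ p
  else (n : ℝ) ^ (p - 2) * (p * (p - 1) / 2) * (|r| - n) ^ 2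
      + p * (n : ℝ) ^ (p - 1) * (|r| - n) + (n : ℝ) ^ p

/-- Gluing two functions whose values and derivatives agree at `a` gives a function
differentiable wherever both pieces are. -/
theorem hasDerivAt_ite_lt {f g f' g' : ℝ → ℝ} {a x : ℝ} (hf : HasDerivAt f (f' x) x)
    (hg : HasDerivAt g (g' x) x) (h : f a = g a) (h' : f' a = g' a) :
    HasDerivAt (fun y => if y < a then f y else g y) (if x < a then f' x else g' x) x := by
  rcases lt_trichotomy x a with hx | rfl | hx
  · rw [if_pos hx]
    refine hf.congr_of_eventuallyEq ?_
    filter_upwards [Iio_mem_nhds hx] with y hy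
    exact if_pos hy
  · rw [if_neg (lt_irrefl x)]
    rw [h'] at hf
    have hl : HasDerivWithinAt (fun y => if y < x then f y else g y) (g' x) (Set.Iio x) x :=
      hf.hasDerivWithinAt.congr (fun y hy => if_pos hy) (by simp [h])
    have hr : HasDerivWithinAt (fun y => if y < x then f y else g y) (g' x) (Set.Ici x) x :=
      hg.hasDerivWithinAt.congr (fun y hy => if_neg (not_lt.2 hy)) (by simp)
    have hu := hl.union hr
    rwa [Set.Iio_union_Ici, hasDerivWithinAt_univ] at hu
  · rw [if_neg (not_lt.2 hx.le)]
    refine hg.congr_of_eventuallyEq ?_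
    filter_upwards [Ioi_mem_nhds hx] with y hy
    exact if_neg (not_lt.2 (le_of_lt hy))

theorem phi_neg (p : ℝ) (n : ℕ) (r : ℝ) : phi p n (-r) = phi p n r := by
  simp [phi]

theorem deriv_phi_neg (p : ℝ) (n : ℕ) (r : ℝ) :
    deriv (phi p n) (-r) = -deriv (phi p n) r := by
  have h := deriv_comp_neg (phi p n) r
  simp only [phi_neg] at h
  linarith

theorem deriv_deriv_phi_neg (p : ℝ) (n : ℕ) (r : ℝ) :
    deriv (deriv (phi p n)) (-r) = deriv (deriv (phi p n)) r := by
  have h := deriv_comp_neg (deriv (phi p n)) r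
  simp only [deriv_phi_neg] at h
  rw [deriv.fun_neg] at h
  linarith

theorem hasDerivAt_phi (p : ℝ) (n : ℕ) {r : ℝ} (hr : 0 < r) :
    HasDerivAt (phi p n) (if r < n then p * r ^ (p - 1)
      else (n : ℝ) ^ (p - 2) * (p * (p - 1)) * (r - n) + p * (n : ℝ) ^ (p - 1)) r := by
  have hf : HasDerivAt (fun x : ℝ => x ^ p) (p * r ^ (p - 1)) r :=
    Real.hasDerivAt_rpow_const (Or.inl hr.ne')
  have hs : HasDerivAt (fun x : ℝ => x - n) 1 r := (hasDerivAt_id r).sub_const _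
  have hg : HasDerivAt (fun x : ℝ => (n : ℝ) ^ (p - 2) * (p * (p - 1) / 2) * (x - n) ^ 2
      + p * (n : ℝ) ^ (p - 1) * (x - n) + (n : ℝ) ^ p)
      ((n : ℝ) ^ (p - 2) * (p * (p - 1)) * (r - n) + p * (n : ℝ) ^ (p - 1)) r := by
    refine ((((hs.pow 2).const_mul ((n : ℝ) ^ (p - 2) * (p * (p - 1) / 2))).add
      (hs.const_mul (p * (n : ℝ) ^ (p - 1)))).add_const ((n : ℝ) ^ p)).congr_deriv ?_
    push_cast
    ring
  refine (hasDerivAt_ite_lt (a := n) (f' := fun x => p * x ^ (p - 1))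
    (g' := fun x => (n : ℝ) ^ (p - 2) * (p * (p - 1)) * (x - n) + p * (n : ℝ) ^ (p - 1))
    hf hg (by simp) (by simp)).congr_of_eventuallyEq ?_
  filter_upwards [Ioi_mem_nhds hr] with y hy
  simp only [phi, abs_of_pos (Set.mem_Ioi.1 hy)]

theorem hasDerivAt_deriv_phi (p : ℝ) (n : ℕ) {r : ℝ} (hr : 0 < r) :
    HasDerivAt (deriv (phi p n)) (if r < n then p * ((p - 1) * r ^ (p - 2))
      else (n : ℝ) ^ (p - 2) * (p * (p - 1))) r := by
  have hf : HasDerivAt (fun x : ℝ => p * x ^ (p - 1)) (p * ((p - 1) * r ^ (p - 2))) r := by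
    have h := (Real.hasDerivAt_rpow_const (x := r) (p := p - 1) (Or.inl hr.ne')).const_mul p
    rwa [show p - 1 - 1 = p - 2 by ring] at h
  have hs : HasDerivAt (fun x : ℝ => x - n) 1 r := (hasDerivAt_id r).sub_const _
  have hg : HasDerivAt (fun x : ℝ => (n : ℝ) ^ (p - 2) * (p * (p - 1)) * (x - n)
      + p * (n : ℝ) ^ (p - 1)) ((n : ℝ) ^ (p - 2) * (p * (p - 1))) r := by
    simpa using (hs.const_mul ((n : ℝ) ^ (p - 2) * (p * (p - 1)))).add_const
      (p * (n : ℝ) ^ (p - 1))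
  refine (hasDerivAt_ite_lt (a := n) (f' := fun x => p * ((p - 1) * x ^ (p - 2)))
    (g' := fun _ => (n : ℝ) ^ (p - 2) * (p * (p - 1)))
    hf hg (by simp) (by ring)).congr_of_eventuallyEq ?_
  filter_upwards [Ioi_mem_nhds hr] with y hy
  exact (hasDerivAt_phi p n hy).deriv

theorem sq_deriv_phi_le_of_pos {p : ℝ} (hp : 2 ≤ p) {n : ℕ} (hn : 1 ≤ n) {r : ℝ} (hr : 0 < r) :
    (deriv (phi p n) r) ^ 2 ≤ 4 * p * deriv (deriv (phi p n)) r * phi p n r := by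
  have rpow_sub_one_eq {x : ℝ} (hx : 0 < x) : x ^ (p - 1) = x ^ (p - 2) * x := by
    rw [← Real.rpow_add_one hx.ne']
    congr 1
    ring
  have rpow_eq {x : ℝ} (hx : 0 < x) : x ^ p = x ^ (p - 2) * x ^ 2 := by
    rw [← Real.rpow_natCast, ← Real.rpow_add hx]
    congr 1
    push_cast
    ring
  rw [(hasDerivAt_phi p n hr).deriv, (hasDerivAt_deriv_phi p n hr).deriv, phi, abs_of_pos hr]
  split_ifs with h
  · rw [rpow_sub_one_eq hr, rpow_eq hr]
    have : 0 ≤ (p * r ^ (p - 2) * r) ^ 2 * (4 * (p - 1) - 1) :=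
      mul_nonneg (sq_nonneg _) (by linarith)
    linarith
  · have hn0 : (0 : ℝ) < n := by exact_mod_cast hn
    rw [rpow_sub_one_eq hn0, rpow_eq hn0]
    obtain ⟨s, hs⟩ : ∃ s, s = r - n := ⟨_, rfl⟩
    have hs0 : 0 ≤ s := by linarith
    rw [← hs]
    obtain ⟨q, rfl⟩ : ∃ q, p = q + 1 := ⟨p - 1, by ring⟩
    have hq : 1 ≤ q := by linarith
    have key : 0 ≤ (((q + 1) * (n : ℝ) ^ (q + 1 - 2)) ^ 2) *
        (q ^ 2 * s ^ 2 * (2 * q + 1) + q * (n * s) * (4 * q + 2) + (4 * q - 1) * (n : ℝ) ^ 2) := by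
      have : 0 ≤ 4 * q - 1 := by linarith
      positivity
    linarith

/-- For `p ≥ 2` and `n ≥ 1`, `(φ_n'(r))² ≤ 4p φ_n''(r) φ_n(r)`
for every `r ∈ ℝ`. -/
theorem statement11 (p : ℝ) (hp : 2 ≤ p) (n : ℕ) (hn : 1 ≤ n) (r : ℝ) :
    (deriv (phi p n) r) ^ 2 ≤ 4 * p * deriv (deriv (phi p n)) r * phi p n r := by
  rcases lt_trichotomy r 0 with hr | rfl | hr
  · have h := sq_deriv_phi_le_of_pos hp hn (neg_pos.2 hr)
    rwa [deriv_phi_neg, deriv_deriv_phi_neg, phi_neg, neg_sq] at h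
  · have hd : deriv (phi p n) 0 = 0 := by
      have h := deriv_phi_neg p n 0
      rw [neg_zero] at h
      linarith
    have h0 : phi p n 0 = 0 := by
      have hn0 : (0 : ℝ) < n := by exact_mod_cast hn
      rw [phi, abs_zero, if_pos hn0, Real.zero_rpow (by linarith)]
    simp [hd, h0]
  · exact sq_deriv_phi_le_of_pos hp hn hr
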